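/- Let n ≥ 1 and d be integers with |d| ≥ 2, with d-sequence n = n_0 > n_1 > ⋯ > n_k = n_{k+1} and d_i = gcd(n_i, |d|). Let Σ_0(n,d) and S_0(n,d) denote the kernels of the endomorphism g ↦ d^k·g on Σ(n,d) and on S(n,d), respectively. Then Σ_0(n,d) ≅ ⊕_{i=0}^{k−1} (ℤ/|d|^{i+1})^{n_i − 2n_{i+1} + n_{i+2}} and S_0(n,d) ≅ ⊕_{i=0}^{k−1} ( ℤ/(|d|^{i+1}/d_i) ⊕ (ℤ/|d|^{i+1})^{n_i − 2n_{i+1} + n_{i+2} − 1} ). -/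

import Mathlib

open Finset

noncomputable section

/-- The ring `ℤ[x]/(x^n - 1)`, realized as the group algebra `ℤ[ℤ/n]`;
the class of `x^j` (for `j : ℤ`) corresponds to `xp n (j : ZMod n)`. -/
abbrev Rn (n : ℕ) : Type := AddMonoidAlgebra ℤ (ZMod n)

/-- The class of `x^w` in `ℤ[x]/(x^n - 1)`. -/
def xp (n : ℕ) (w : ZMod n) : Rn n := AddMonoidAlgebra.single w 1

/-- `e_v = x^v - 1`. -/
def eV (n : ℕ) (w : ZMod n) : Rn n := xp n w - 1

/-- `ε_v = d·e_v - e_{d·v}`. -/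
def epsV (n : ℕ) (d : ℤ) (w : ZMod n) : Rn n := d • eV n w - eV n ((d : ZMod n) * w)

/-- `𝒵_n`, the ℤ-span of the `e_v`, `1 ≤ v ≤ n-1`. -/
def ZSpan (n : ℕ) : Submodule ℤ (Rn n) :=
  Submodule.span ℤ {a : Rn n | ∃ v : ℤ, 1 ≤ v ∧ v ≤ (n : ℤ) - 1 ∧ a = eV n (v : ZMod n)}

/-- `ℰ_{n,d}`, the ℤ-span of the `ε_v`, `1 ≤ v ≤ n-1`. -/
def ESpan (n : ℕ) (d : ℤ) : Submodule ℤ (Rn n) :=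
  Submodule.span ℤ {a : Rn n | ∃ v : ℤ, 1 ≤ v ∧ v ≤ (n : ℤ) - 1 ∧ a = epsV n d (v : ZMod n)}

/-- `1 + x + ⋯ + x^{|d|-1}`. -/
def geomT (n : ℕ) (d : ℤ) : Rn n := ∑ i ∈ Finset.range d.natAbs, xp n (i : ZMod n)

/-- `f_v`: the Laplacian row polynomial of `DB(n,d)` (for `d ≥ 0`) resp. of
`Ktz(n,|d|)` (for `d < 0`). -/
def fV (n : ℕ) (d : ℤ) (v : ℤ) : Rn n :=
  if 0 ≤ d then d • xp n ((v : ZMod n)) - xp n (((d * v : ℤ) : ZMod n)) * geomT n d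
  else d • xp n ((v : ZMod n)) + xp n (((d * (v + 1) : ℤ) : ZMod n)) * geomT n d

/-- `F_{n,d}`, the ℤ-span of the `f_v`, `1 ≤ v ≤ n-1`. -/
def FSpan (n : ℕ) (d : ℤ) : Submodule ℤ (Rn n) :=
  Submodule.span ℤ {a : Rn n | ∃ v : ℤ, 1 ≤ v ∧ v ≤ (n : ℤ) - 1 ∧ a = fV n d v}

/-- The sand dune group `Σ(n,d) = 𝒵_n / ℰ_{n,d}`. -/
abbrev SandDune (n : ℕ) (d : ℤ) :=
  ZSpan n ⧸ Submodule.comap (ZSpan n).subtype (ESpan n d)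

/-- The sandpile (critical) group `S(n,d) = 𝒵_n / F_{n,d}`. -/
abbrev Sandpile (n : ℕ) (d : ℤ) :=
  ZSpan n ⧸ Submodule.comap (ZSpan n).subtype (FSpan n d)

/-- The `d`-sequence of `n`: `n_0 = n`, `n_{i+1} = n_i / gcd(n_i, |d|)`. -/
def dSeq (n : ℕ) (d : ℤ) : ℕ → ℕ
  | 0 => n
  | i + 1 => dSeq n d i / Nat.gcd (dSeq n d i) d.natAbs

open Polynomial in
lemma X_pow_dvd_of_sum_aeval_eq_zero {M ι : Type*} [AddCommGroup M] [Fintype ι]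
    (T : M →ₗ[ℤ] M) (h : ι → ℕ) (b : ι → M)
    (hb : ∀ i, (T ^ (h i + 1)) (b i) = 0)
    (hli : ∀ c : ι → ℤ, ∑ i, c i • (T ^ h i) (b i) = 0 → ∀ i, c i = 0)
    (a : ι → ℤ[X]) (ha : ∑ i, aeval T (a i) (b i) = 0) (i : ι) :
    (X : ℤ[X]) ^ (h i + 1) ∣ a i := by
  have hbig : ∀ i m, h i < m → (T ^ m) (b i) = 0 := by
    intro i m hm
    obtain ⟨t, rfl⟩ := Nat.exists_eq_add_of_lt hm
    rw [show h i + t + 1 = t + (h i + 1) by ring, pow_add, Module.End.mul_apply, hb, map_zero]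
  have key : ∀ s t, (∀ i, h i < s + t) → ∀ i, (X : ℤ[X]) ^ (h i + 1 - s) ∣ a i := by
    intro s t
    induction t generalizing s with
    | zero =>
      intro hs i
      rw [Nat.sub_eq_zero_of_le (by have := hs i; omega), pow_zero]
      exact one_dvd _
    | succ t ih =>
      intro hs
      have hq := ih (s + 1) (fun i => by have := hs i; omega)
      choose q hq using hq
      have hs0 : ∑ i, (if s ≤ h i then (q i).coeff 0 else 0) • (T ^ h i) (b i) = 0 := by
        rw [← map_zero (T ^ s), ← ha, map_sum]
        refine Finset.sum_congr rfl fun i _ => ?_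
        rw [← Module.End.mul_apply, show T ^ s * aeval T (a i) = aeval T (X ^ s * a i) by simp,
          hq i, ← mul_assoc, ← pow_add]
        split_ifs with hi
        · rw [show s + (h i + 1 - (s + 1)) = h i by omega]
          obtain ⟨r, hr⟩ := X_dvd_sub_C (p := q i)
          rw [sub_eq_iff_eq_add] at hr
          conv_rhs => rw [hr]
          rw [mul_add, ← mul_assoc, ← pow_succ, map_add, mul_comm, map_mul, LinearMap.add_apply,
            Module.End.mul_apply]
          simp [hb]
        · rw [mul_comm, map_mul, Module.End.mul_apply]
          simp [hbig i (s + (h i - s)) (by omega)]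
      intro i
      have h0 := hli _ hs0 i
      by_cases hi : s ≤ h i
      · rw [if_pos hi, ← X_dvd_iff] at h0
        rw [hq i, show h i + 1 - s = (h i + 1 - (s + 1)) + 1 by omega, pow_succ]
        exact mul_dvd_mul_left _ h0
      · rw [Nat.sub_eq_zero_of_le (by omega), pow_zero]
        exact one_dvd _
  exact key 0 (∑ i, h i + 1) (fun i => by
    have := Finset.single_le_sum (f := h) (fun i _ => Nat.zero_le _) (Finset.mem_univ i)
    omega) i

open Polynomial in
lemma exists_eq_sum_aeval {M ι : Type*} [AddCommGroup M] [Fintype ι]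
    (T : M →ₗ[ℤ] M) (h : ι → ℕ) (b : ι → M)
    (hspan : ∀ j x, T x = 0 → x ∈ LinearMap.range (T ^ j) →
      ∃ c : ι → ℤ, (∀ i, h i < j → c i = 0) ∧ x = ∑ i, c i • (T ^ h i) (b i))
    (s : ℕ) (x : M) (hx : (T ^ s) x = 0) :
    ∃ a : ι → ℤ[X], x = ∑ i, aeval T (a i) (b i) := by
  induction s generalizing x with
  | zero => exact ⟨0, by simpa using hx⟩
  | succ s ih =>
    obtain ⟨c, hc, hcx⟩ := hspan s ((T ^ s) x)
      (by rwa [← Module.End.mul_apply, ← pow_succ']) ⟨x, rfl⟩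
    obtain ⟨a, ha⟩ := ih (x - ∑ i, c i • (T ^ (h i - s)) (b i)) (by
      rw [map_sub, hcx, map_sum, sub_eq_zero]
      refine Finset.sum_congr rfl fun i _ => ?_
      by_cases hi : h i < s
      · simp [hc i hi]
      · rw [map_smul, ← Module.End.mul_apply, ← pow_add, show s + (h i - s) = h i by omega])
    refine ⟨fun i => a i + C (c i) * X ^ (h i - s), ?_⟩
    rw [sub_eq_iff_eq_add] at ha
    rw [ha, ← Finset.sum_add_distrib]
    refine Finset.sum_congr rfl fun i _ => ?_
    simp

open Polynomial in
/-- Modulo `(d - T)`, an element of the span of the Jordan chains is a combination of the tops. -/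
lemma exists_sum_smul_add_sub {M ι : Type*} [AddCommGroup M] [Fintype ι]
    (T : M →ₗ[ℤ] M) (Z : Submodule ℤ M) (hZ : ∀ x ∈ Z, T x ∈ Z) (d : ℤ) (b : ι → M)
    (hbZ : ∀ i, b i ∈ Z) (a : ι → ℤ[X]) :
    ∃ c : ι → ℤ, ∃ y ∈ Z, ∑ i, aeval T (a i) (b i) = ∑ i, c i • b i + (d • y - T y) := by
  have hp : ∀ p : ℤ[X], ∀ x ∈ Z, aeval T p x ∈ Z := by
    intro p x hx
    induction p using Polynomial.induction_on' with
    | add p q hp hq => simpa using Z.add_mem hp hq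
    | monomial m r =>
      have : ∀ m, (T ^ m) x ∈ Z := by
        intro m
        induction m with
        | zero => simpa
        | succ m ih => rw [pow_succ']; exact hZ _ ih
      simpa [aeval_monomial] using Z.smul_mem r (this m)
  choose q hq using fun i => X_sub_C_dvd_sub_C_eval (p := a i) (a := d)
  refine ⟨fun i => (a i).eval d, ∑ i, aeval T (-q i) (b i),
    Z.sum_mem fun i _ => hp _ _ (hbZ i), ?_⟩
  rw [map_sum, Finset.smul_sum, ← Finset.sum_sub_distrib, ← Finset.sum_add_distrib]
  refine Finset.sum_congr rfl fun i _ => ?_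
  rw [eq_add_of_sub_eq (hq i)]
  simp
  abel

open Polynomial in
lemma pow_dvd_of_sum_smul_eq {M ι : Type*} [AddCommGroup M] [Fintype ι]
    (T : M →ₗ[ℤ] M) (h : ι → ℕ) (b : ι → M)
    (hb : ∀ i, (T ^ (h i + 1)) (b i) = 0)
    (hli : ∀ c : ι → ℤ, ∑ i, c i • (T ^ h i) (b i) = 0 → ∀ i, c i = 0)
    (d : ℤ) (c : ι → ℤ) (a : ι → ℤ[X])
    (hc : ∑ i, c i • b i = d • (∑ i, aeval T (a i) (b i)) - T (∑ i, aeval T (a i) (b i)))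
    (i : ι) : d ^ (h i + 1) ∣ c i := by
  have := X_pow_dvd_of_sum_aeval_eq_zero T h b hb hli (fun i => C (c i) - (C d - X) * a i) (by
    rw [map_sum, Finset.smul_sum, ← Finset.sum_sub_distrib, ← sub_eq_zero,
      ← Finset.sum_sub_distrib] at hc
    rw [← hc]
    refine Finset.sum_congr rfl fun i _ => ?_
    simp) i
  simpa using eval_dvd (x := d) this

lemma exists_pow_smul_sub_pow_apply_eq {M : Type*} [AddCommGroup M]
    (T : M →ₗ[ℤ] M) (Z : Submodule ℤ M) (hZ : ∀ x ∈ Z, T x ∈ Z) (d : ℤ) (m : ℕ) (x : M)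
    (hx : x ∈ Z) : ∃ y ∈ Z, d ^ m • x - (T ^ m) x = d • y - T y := by
  induction m with
  | zero => exact ⟨0, Z.zero_mem, by simp⟩
  | succ m ih =>
    obtain ⟨y, hy, h⟩ := ih
    refine ⟨T y + d ^ m • x, Z.add_mem (hZ _ hy) (Z.smul_mem _ hx), ?_⟩
    rw [sub_eq_iff_eq_add] at h
    rw [pow_succ', mul_smul, pow_succ', Module.End.mul_apply]
    have h2 := congrArg T h
    simp only [map_add, map_sub, map_smul, smul_add] at h2 ⊢
    rw [h2]
    abel

/-- The vectors `b i`, with `T ^ (h i + 1)` killing `b i`, are the tops of Jordan chains of `T`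
whose bottoms `T ^ (h i) (b i)` form a basis of `ker T` compatible with its filtration by the
ranges of the powers of `T`. -/
structure IsChainFamily {M ι : Type*} [AddCommGroup M] [Fintype ι]
    (T : M →ₗ[ℤ] M) (h : ι → ℕ) (b : ι → M) : Prop where
  pow_apply_eq_zero : ∀ i, (T ^ (h i + 1)) (b i) = 0
  eq_zero_of_sum_eq_zero : ∀ c : ι → ℤ, ∑ i, c i • (T ^ h i) (b i) = 0 → ∀ i, c i = 0
  exists_eq_sum : ∀ j x, T x = 0 → x ∈ LinearMap.range (T ^ j) →
    ∃ c : ι → ℤ, (∀ i, h i < j → c i = 0) ∧ x = ∑ i, c i • (T ^ h i) (b i)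

namespace IsChainFamily

variable {M ι : Type*} [AddCommGroup M] [Fintype ι] {T : M →ₗ[ℤ] M} {h : ι → ℕ} {b : ι → M}
  {Z : Submodule ℤ M} {d : ℤ}

lemma pow_smul_mem (H : IsChainFamily T h b) (hZ : ∀ x ∈ Z, T x ∈ Z) (hbZ : ∀ i, b i ∈ Z) (i : ι) :
    d ^ (h i + 1) • b i ∈ Z.map (d • LinearMap.id - T) := by
  obtain ⟨y, hy, e⟩ := exists_pow_smul_sub_pow_apply_eq T Z hZ d (h i + 1) (b i) (hbZ i)
  rw [H.pow_apply_eq_zero, sub_zero] at e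
  exact ⟨y, hy, by simp [e]⟩

lemma sum_smul_mem_iff (H : IsChainFamily T h b) (hZ : ∀ x ∈ Z, T x ∈ Z) (hbZ : ∀ i, b i ∈ Z)
    [Module.IsTorsionFree ℤ M] (hd : 2 ≤ |d|) {N : ℕ} (hN : N ≠ 0) (hT : T ^ N * T ^ N = T ^ N)
    (c : ι → ℤ) :
    ∑ i, c i • b i ∈ Z.map (d • LinearMap.id - T) ↔ ∀ i, d ^ (h i + 1) ∣ c i := by
  constructor
  · rintro ⟨y, -, hy⟩
    have hy : d • y - T y = ∑ i, c i • b i := hy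
    have hT' : ∀ t, T ^ N = T ^ (N * (t + 1)) := by
      intro t
      induction t with
      | zero => simp
      | succ t ih => rw [mul_add N (t + 1), mul_one, pow_add, ← ih, hT]
    have hz : (T ^ N) (d • y - T y) = 0 := by
      rw [hy, map_sum]
      refine Finset.sum_eq_zero fun i _ => ?_
      obtain ⟨u, hu⟩ : ∃ u, N * (h i + 1 + 1) = u + (h i + 1) :=
        ⟨_, (Nat.sub_add_cancel (by nlinarith [Nat.pos_of_ne_zero hN])).symm⟩
      rw [hT' (h i + 1), hu, pow_add, map_smul, Module.End.mul_apply, H.pow_apply_eq_zero,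
        map_zero, smul_zero]
    have h1 : T ((T ^ N) y) = d • (T ^ N) y := by
      rw [map_sub, map_smul, sub_eq_zero] at hz
      rw [hz, ← Module.End.mul_apply, ← Module.End.mul_apply, ← pow_succ, ← pow_succ']
    have h2 : ∀ m, (T ^ m) ((T ^ N) y) = d ^ m • (T ^ N) y := by
      intro m
      induction m with
      | zero => simp
      | succ m ih => rw [pow_succ', Module.End.mul_apply, ih, map_smul, h1, smul_smul, ← pow_succ]
    have h3 : (T ^ N) y = 0 := by
      have h4 := h2 N
      rw [← Module.End.mul_apply, hT] at h4
      have h5 : (d ^ N - 1) • (T ^ N) y = 0 := by rw [sub_smul, ← h4, one_smul, sub_self]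
      refine (smul_eq_zero.1 h5).resolve_left fun h6 => ?_
      have h7 : |d| ^ N = 1 := by rw [← abs_pow, sub_eq_zero.1 h6, abs_one]
      have := one_lt_pow₀ (by omega : 1 < |d|) hN
      omega
    obtain ⟨a, rfl⟩ := exists_eq_sum_aeval T h b H.exists_eq_sum N y h3
    exact pow_dvd_of_sum_smul_eq T h b H.pow_apply_eq_zero H.eq_zero_of_sum_eq_zero d c a hy.symm
  · intro hc
    refine Submodule.sum_mem _ fun i _ => ?_
    obtain ⟨q, hq⟩ := hc i
    rw [hq, mul_comm, mul_smul]
    exact Submodule.smul_mem _ _ (H.pow_smul_mem hZ hbZ i)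

lemma exists_sub_sum_mem (H : IsChainFamily T h b) (hZ : ∀ x ∈ Z, T x ∈ Z) (hbZ : ∀ i, b i ∈ Z)
    {N : ℕ} (hN : N ≠ 0) (hT : T ^ N * T ^ N = T ^ N) (k : ℕ) (x : M) (hx : x ∈ Z)
    (hkx : d ^ k • x ∈ Z.map (d • LinearMap.id - T)) :
    ∃ c : ι → ℤ, x - ∑ i, c i • b i ∈ Z.map (d • LinearMap.id - T) := by
  have hEZ : ∀ x ∈ Z.map (d • LinearMap.id - T), T x ∈ Z.map (d • LinearMap.id - T) := by
    rintro _ ⟨y, hy, rfl⟩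
    exact ⟨T y, hZ y hy, by simp⟩
  have hTk : (T ^ k) x ∈ Z.map (d • LinearMap.id - T) := by
    obtain ⟨y, hy, e⟩ := exists_pow_smul_sub_pow_apply_eq T Z hZ d k x hx
    rw [sub_eq_iff_eq_add', ← sub_eq_iff_eq_add] at e
    rw [← e]
    exact Submodule.sub_mem _ hkx ⟨y, hy, by simp⟩
  have hT' : ∀ t, T ^ N = T ^ (N * (t + 1)) := by
    intro t
    induction t with
    | zero => simp
    | succ t ih => rw [mul_add N (t + 1), mul_one, pow_add, ← ih, hT]
  have hTm : ∀ m, (T ^ (m + k)) x ∈ Z.map (d • LinearMap.id - T) := by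
    intro m
    induction m with
    | zero => simpa
    | succ m ih =>
      rw [show m + 1 + k = (m + k) + 1 by ring, pow_succ']
      exact hEZ _ ih
  have hTN : (T ^ N) x ∈ Z.map (d • LinearMap.id - T) := by
    obtain ⟨u, hu⟩ : ∃ u, N * (k + 1) = u + k :=
      ⟨_, (Nat.sub_add_cancel (by nlinarith [Nat.pos_of_ne_zero hN])).symm⟩
    rw [hT' k, hu]
    exact hTm u
  obtain ⟨a, ha⟩ := exists_eq_sum_aeval T h b H.exists_eq_sum N (x - (T ^ N) x) (by
    rw [map_sub, ← Module.End.mul_apply, hT, sub_self])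
  obtain ⟨c, y, hy, e⟩ := exists_sum_smul_add_sub T Z hZ d b hbZ a
  refine ⟨c, ?_⟩
  rw [← ha, sub_eq_iff_eq_add] at e
  rw [e, show ∑ i, c i • b i + (d • y - T y) + (T ^ N) x - ∑ i, c i • b i =
    (d • y - T y) + (T ^ N) x by abel]
  exact Submodule.add_mem _ ⟨y, hy, by simp⟩ hTN

end IsChainFamily

lemma nonempty_addEquiv_of_range_eq_of_ker_eq {G A X C : Type*} [AddCommGroup G] [AddCommGroup A]
    [AddCommGroup X] [AddCommGroup C] (f : G →+ X) (hf : Function.Injective f) (g : A →+ X)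
    (hfg : f.range = g.range) (h : A →+ C) (hh : Function.Surjective h) (hgh : g.ker = h.ker) :
    Nonempty (G ≃+ C) :=
  ⟨(AddMonoidHom.ofInjective hf).trans <| (AddEquiv.addSubgroupCongr hfg).trans <|
    (QuotientAddGroup.quotientKerEquivRange g).symm.trans <|
    (QuotientAddGroup.quotientAddEquivOfEq hgh).trans <|
    QuotientAddGroup.quotientKerEquivOfSurjective h hh⟩

/-- A saturated submodule `B ≤ A` of a finitely generated abelian group admits a complement in `A`
with an explicit basis. -/
lemma exists_complement_basis {M : Type*} [AddCommGroup M] [Module.Finite ℤ M]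
    (A B : Submodule ℤ M) (hBA : B ≤ A)
    (hsat : ∀ m : ℤ, m ≠ 0 → ∀ x ∈ A, m • x ∈ B → x ∈ B) (r : ℕ)
    (hr : Module.finrank ℤ A = Module.finrank ℤ B + r) :
    ∃ u : Fin r → M, (∀ a, u a ∈ A) ∧ (∀ x ∈ A, ∃ c : Fin r → ℤ, x - ∑ a, c a • u a ∈ B) ∧
      ∀ c : Fin r → ℤ, ∑ a, c a • u a ∈ B → ∀ a, c a = 0 := by
  set B' := B.comap A.subtype with hB'
  have : Module.IsTorsionFree ℤ (A ⧸ B') := by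
    refine Module.IsTorsionFree.mk fun m hm => ?_
    have hm := hm.ne_zero
    intro x y hxy
    rw [← sub_eq_zero] at hxy ⊢
    simp only [← smul_sub] at hxy
    generalize x - y = z at hxy
    obtain ⟨z, rfl⟩ := Submodule.Quotient.mk_surjective _ z
    rw [← Submodule.Quotient.mk_smul, Submodule.Quotient.mk_eq_zero] at hxy
    rw [Submodule.Quotient.mk_eq_zero]
    exact hsat m hm z z.2 hxy
  have hfr : Module.finrank ℤ (A ⧸ B') = r := by
    have h1 := Submodule.finrank_quotient_add_finrank B'
    have h2 : Module.finrank ℤ B' = Module.finrank ℤ B :=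
      (Submodule.comapSubtypeEquivOfLe hBA).finrank_eq
    omega
  let e := Module.finBasisOfFinrankEq ℤ (A ⧸ B') hfr
  choose u hu using fun a => Submodule.Quotient.mk_surjective B' (e a)
  have hmk : ∀ c : Fin r → ℤ, Submodule.Quotient.mk (p := B') (∑ a, c a • u a) = ∑ a, c a • e a := by
    intro c
    rw [← Submodule.mkQ_apply, map_sum]
    refine Finset.sum_congr rfl fun a _ => ?_
    rw [map_smul, Submodule.mkQ_apply, hu]
  refine ⟨fun a => u a, fun a => (u a).2, fun x hx => ?_, fun c hc => ?_⟩
  · refine ⟨e.repr (Submodule.Quotient.mk ⟨x, hx⟩), ?_⟩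
    have : (⟨x, hx⟩ : A) - ∑ a, e.repr (Submodule.Quotient.mk ⟨x, hx⟩) a • u a ∈ B' := by
      rw [← Submodule.Quotient.mk_eq_zero, Submodule.Quotient.mk_sub, hmk, e.sum_repr, sub_self]
    simpa [hB'] using this
  · have : ∑ a, c a • u a ∈ B' := by simpa [hB'] using hc
    rw [← Submodule.Quotient.mk_eq_zero, hmk] at this
    exact Fintype.linearIndependent_iff.1 e.linearIndependent c this

/-- The linear map on `Rn n` determined by its values on the classes of the powers of `x`. -/
def liftXp {P : Type*} [AddCommGroup P] (n : ℕ) (φ : ZMod n → P) : Rn n →ₗ[ℤ] P :=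
  (AddMonoidAlgebra.basis (ZMod n) ℤ).constr ℤ φ

@[simp]
lemma liftXp_xp {P : Type*} [AddCommGroup P] (n : ℕ) (φ : ZMod n → P) (w : ZMod n) :
    liftXp n φ (xp n w) = φ w :=
  (AddMonoidAlgebra.basis (ZMod n) ℤ).constr_basis ℤ φ w

lemma linearMap_ext_xp {n : ℕ} {P : Type*} [AddCommGroup P] {f g : Rn n →ₗ[ℤ] P}
    (h : ∀ w, f (xp n w) = g (xp n w)) : f = g :=
  (AddMonoidAlgebra.basis (ZMod n) ℤ).ext h

lemma range_liftXp {P : Type*} [AddCommGroup P] (n : ℕ) (φ : ZMod n → P) :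
    LinearMap.range (liftXp n φ) = Submodule.span ℤ (Set.range φ) :=
  (AddMonoidAlgebra.basis (ZMod n) ℤ).constr_range ℤ

lemma coeff_xp (n : ℕ) (v w : ZMod n) [Decidable (v = w)] :
    (xp n v).coeff w = if v = w then 1 else 0 := by
  classical
  simp [xp, Finsupp.single_apply]

lemma mem_span_xp_iff {n : ℕ} (S : Set (ZMod n)) (x : Rn n) :
    x ∈ Submodule.span ℤ (xp n '' S) ↔ ∀ v ∉ S, x.coeff v = 0 := by
  rw [← AddMonoidAlgebra.mem_supported' (R := ℤ), AddMonoidAlgebra.supported_eq_span_single]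
  rfl

lemma finrank_span_xp {n : ℕ} [NeZero n] (S : Set (ZMod n)) :
    Module.finrank ℤ (Submodule.span ℤ (xp n '' S)) = Nat.card S := by
  have hli : LinearIndependent ℤ fun w : S => xp n w :=
    (AddMonoidAlgebra.basis (ZMod n) ℤ).linearIndependent.comp _ Subtype.val_injective
  have := Fintype.ofFinite S
  rw [Nat.card_eq_fintype_card, ← finrank_span_eq_card hli, Set.image_eq_range]

instance (n : ℕ) [NeZero n] : Module.Finite ℤ (Rn n) :=
  Module.Finite.of_basis (AddMonoidAlgebra.basis (ZMod n) ℤ)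

/-- The endomorphism `x^v ↦ x^{d·v}` of `Rn n`. -/
def mulMap (n : ℕ) (d : ℤ) : Rn n →ₗ[ℤ] Rn n := liftXp n fun w => xp n ((d : ZMod n) * w)

/-- The map `Rn n → ℤ/n` sending the class of `x^v` to `v`. -/
def posMap (n : ℕ) : Rn n →ₗ[ℤ] ZMod n := liftXp n id

/-- The augmentation of `Rn n`. -/
def augMap (n : ℕ) : Rn n →ₗ[ℤ] ℤ := liftXp n fun _ => 1

lemma mulMap_pow (n : ℕ) (d : ℤ) (j : ℕ) :
    mulMap n d ^ j = liftXp n fun w => xp n ((d : ZMod n) ^ j * w) := by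
  induction j with
  | zero => exact linearMap_ext_xp fun w => by simp
  | succ j ih =>
    refine linearMap_ext_xp fun w => ?_
    rw [pow_succ', Module.End.mul_apply, ih, liftXp_xp, mulMap, liftXp_xp, liftXp_xp, pow_succ',
      mul_assoc]

@[simp]
lemma mulMap_pow_xp (n : ℕ) (d : ℤ) (j : ℕ) (w : ZMod n) :
    (mulMap n d ^ j) (xp n w) = xp n ((d : ZMod n) ^ j * w) := by
  rw [mulMap_pow, liftXp_xp]

@[simp]
lemma mulMap_xp (n : ℕ) (d : ℤ) (w : ZMod n) : mulMap n d (xp n w) = xp n ((d : ZMod n) * w) :=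
  liftXp_xp _ _ _

@[simp]
lemma posMap_xp (n : ℕ) (w : ZMod n) : posMap n (xp n w) = w := liftXp_xp _ _ _

@[simp]
lemma augMap_xp (n : ℕ) (w : ZMod n) : augMap n (xp n w) = 1 := liftXp_xp _ _ _

lemma posMap_mulMap_pow (n : ℕ) (d : ℤ) (j : ℕ) (x : Rn n) :
    posMap n ((mulMap n d ^ j) x) = (d : ZMod n) ^ j * posMap n x := by
  have : posMap n ∘ₗ (mulMap n d ^ j) = (d ^ j) • posMap n := linearMap_ext_xp fun w => by simp
  simpa using congrArg (fun f => f x) this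

lemma augMap_mulMap_pow (n : ℕ) (d : ℤ) (j : ℕ) (x : Rn n) :
    augMap n ((mulMap n d ^ j) x) = augMap n x := by
  have : augMap n ∘ₗ (mulMap n d ^ j) = augMap n := linearMap_ext_xp fun w => by simp
  simpa using congrArg (fun f => f x) this

lemma mem_range_mulMap_pow_iff {n : ℕ} {d : ℤ} {j : ℕ} {x : Rn n} :
    x ∈ LinearMap.range (mulMap n d ^ j) ↔
      ∀ v ∉ Set.range (fun w : ZMod n => (d : ZMod n) ^ j * w), x.coeff v = 0 := by
  rw [mulMap_pow, range_liftXp, ← mem_span_xp_iff, ← Set.range_comp]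
  rfl

lemma dSeq_mul_gcd (n : ℕ) (d : ℤ) (i : ℕ) :
    dSeq n d (i + 1) * Nat.gcd (dSeq n d i) d.natAbs = dSeq n d i :=
  Nat.div_mul_cancel (Nat.gcd_dvd_left _ _)

lemma dSeq_dvd {n : ℕ} {d : ℤ} {i j : ℕ} (h : i ≤ j) : dSeq n d j ∣ dSeq n d i := by
  induction j, h using Nat.le_induction with
  | base => exact dvd_rfl
  | succ j _ ih => exact (Nat.div_dvd_of_dvd (Nat.gcd_dvd_left _ _)).trans ih

lemma gcd_pow_mul_dSeq {n : ℕ} (hn : 1 ≤ n) (d : ℤ) (i : ℕ) :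
    Nat.gcd n (d.natAbs ^ i) * dSeq n d i = n := by
  induction i with
  | zero => simp [dSeq]
  | succ i ih =>
    have hg : 0 < Nat.gcd n (d.natAbs ^ i) := Nat.gcd_pos_of_pos_left _ hn
    have hcop := Nat.coprime_div_gcd_div_gcd hg
    set g := Nat.gcd n (d.natAbs ^ i) with hgdef
    have h1 : n / g = dSeq n d i := Nat.div_eq_of_eq_mul_right hg ih.symm
    rw [h1] at hcop
    have h2 : d.natAbs ^ i = g * (d.natAbs ^ i / g) :=
      (Nat.mul_div_cancel' (Nat.gcd_dvd_right _ _)).symm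
    have h3 : Nat.gcd n (d.natAbs ^ (i + 1)) = g * Nat.gcd (dSeq n d i) d.natAbs := by
      rw [pow_succ, h2]
      conv_lhs => rw [← ih]
      rw [mul_assoc, Nat.gcd_mul_left, Nat.Coprime.gcd_mul_left_cancel_right _ hcop.symm]
    rw [h3, mul_assoc, mul_comm (Nat.gcd (dSeq n d i) _), dSeq_mul_gcd, ih]

lemma dSeq_pos {n : ℕ} (hn : 1 ≤ n) (d : ℤ) (i : ℕ) : 0 < dSeq n d i :=
  Nat.pos_of_dvd_of_pos (dSeq_dvd (Nat.zero_le i)) hn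

lemma dvd_pow_mul_iff {n : ℕ} (hn : 1 ≤ n) (d : ℤ) (i : ℕ) (a : ℤ) :
    (n : ℤ) ∣ d ^ i * a ↔ (dSeq n d i : ℤ) ∣ a := by
  rw [Int.natCast_dvd, Int.natCast_dvd, Int.natAbs_mul, Int.natAbs_pow]
  have hg : 0 < Nat.gcd n (d.natAbs ^ i) := Nat.gcd_pos_of_pos_left _ hn
  have hcop := Nat.coprime_div_gcd_div_gcd hg
  have ih := gcd_pow_mul_dSeq hn d i
  set g := Nat.gcd n (d.natAbs ^ i) with hgdef
  have h1 : n / g = dSeq n d i := Nat.div_eq_of_eq_mul_right hg ih.symm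
  have h2 : d.natAbs ^ i = g * (d.natAbs ^ i / g) :=
    (Nat.mul_div_cancel' (Nat.gcd_dvd_right _ _)).symm
  rw [h1] at hcop
  rw [h2, mul_assoc]
  conv_lhs => rw [← ih]
  rw [Nat.mul_dvd_mul_iff_left hg, hcop.dvd_mul_left]

lemma pow_mul_intCast_eq_zero_iff {n : ℕ} (hn : 1 ≤ n) (d : ℤ) (i : ℕ) (a : ℤ) :
    (d : ZMod n) ^ i * (a : ZMod n) = 0 ↔ (dSeq n d i : ℤ) ∣ a := by
  rw [← dvd_pow_mul_iff hn, ← ZMod.intCast_zmod_eq_zero_iff_dvd]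
  push_cast
  rfl

lemma card_range_pow_mul {n : ℕ} (hn : 1 ≤ n) (d : ℤ) (j : ℕ) :
    Nat.card (Set.range (fun w : ZMod n => (d : ZMod n) ^ j * w)) = dSeq n d j := by
  have h1 : Set.range (fun w : ZMod n => (d : ZMod n) ^ j * w) =
      (AddSubgroup.zmultiples ((d : ZMod n) ^ j) : Set (ZMod n)) := by
    ext v
    simp only [Set.mem_range, SetLike.mem_coe, AddSubgroup.mem_zmultiples_iff]
    constructor
    · rintro ⟨w, rfl⟩
      obtain ⟨a, rfl⟩ := ZMod.intCast_surjective w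
      exact ⟨a, by simp [mul_comm]⟩
    · rintro ⟨a, rfl⟩
      exact ⟨a, by simp [mul_comm]⟩
  rw [h1]
  refine (Nat.card_zmultiples _).trans ?_
  have h2 : addOrderOf ((d : ZMod n) ^ j) = addOrderOf ((d.natAbs ^ j : ℕ) : ZMod n) := by
    rcases Int.natAbs_eq (d ^ j) with h | h
    · rw [← Int.cast_pow, h, Int.natAbs_pow, Int.cast_natCast]
    · rw [← Int.cast_pow, h, Int.natAbs_pow, Int.cast_neg, Int.cast_natCast, addOrderOf_neg]
  rw [h2, ZMod.addOrderOf_coe _ (by omega)]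
  exact Nat.div_eq_of_eq_mul_right (Nat.gcd_pos_of_pos_left _ hn) (gcd_pow_mul_dSeq hn d j).symm

lemma finrank_range_mulMap_pow {n : ℕ} (hn : 1 ≤ n) (d : ℤ) (j : ℕ) :
    Module.finrank ℤ (LinearMap.range (mulMap n d ^ j)) = dSeq n d j := by
  have : NeZero n := ⟨by omega⟩
  rw [← card_range_pow_mul hn d j, ← finrank_span_xp, mulMap_pow, range_liftXp, ← Set.range_comp]
  rfl

/-- The filtration of the kernel of `mulMap n d` by the ranges of the powers of `mulMap n d`. -/
def kerFilt (n : ℕ) (d : ℤ) (j : ℕ) : Submodule ℤ (Rn n) :=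
  LinearMap.ker (mulMap n d) ⊓ LinearMap.range (mulMap n d ^ j)

lemma kerFilt_antitone (n : ℕ) (d : ℤ) : Antitone (kerFilt n d) := by
  refine antitone_nat_of_succ_le fun j => inf_le_inf_left _ ?_
  rw [pow_succ]
  exact LinearMap.range_comp_le_range _ _

lemma mem_kerFilt_of_smul_mem {n : ℕ} {d : ℤ} {j : ℕ} {m : ℤ} (hm : m ≠ 0) {x : Rn n}
    (hx : m • x ∈ kerFilt n d j) : x ∈ kerFilt n d j := by
  obtain ⟨h1, h2⟩ := hx
  refine ⟨?_, ?_⟩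
  · have h1 : mulMap n d (m • x) = 0 := h1
    rw [map_smul] at h1
    exact (smul_eq_zero.1 h1).resolve_left hm
  · have h2 : m • x ∈ LinearMap.range (mulMap n d ^ j) := h2
    change x ∈ LinearMap.range (mulMap n d ^ j)
    rw [mem_range_mulMap_pow_iff] at h2 ⊢
    intro v hv
    have := h2 v hv
    simpa [-zsmul_eq_mul, hm] using this

lemma finrank_kerFilt_add {n : ℕ} (hn : 1 ≤ n) (d : ℤ) (j : ℕ) :
    Module.finrank ℤ (kerFilt n d j) + dSeq n d (j + 1) = dSeq n d j := by
  have : NeZero n := ⟨by omega⟩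
  have h := Submodule.finrank_quotient_add_finrank
    (LinearMap.ker ((mulMap n d).domRestrict (LinearMap.range (mulMap n d ^ j))))
  rw [(LinearMap.quotKerEquivRange _).finrank_eq] at h
  have h1 : LinearMap.range ((mulMap n d).domRestrict (LinearMap.range (mulMap n d ^ j))) =
      LinearMap.range (mulMap n d ^ (j + 1)) := by
    rw [LinearMap.range_domRestrict, pow_succ', Module.End.mul_eq_comp, LinearMap.range_comp]
  have h2 : (LinearMap.ker ((mulMap n d).domRestrict (LinearMap.range (mulMap n d ^ j)))).map
      (LinearMap.range (mulMap n d ^ j)).subtype = kerFilt n d j := by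
    rw [LinearMap.ker_domRestrict, Submodule.map_comap_subtype, inf_comm]
    rfl
  rw [h1, finrank_range_mulMap_pow hn, finrank_range_mulMap_pow hn,
    ← Submodule.finrank_map_subtype_eq, h2] at h
  omega

lemma kerFilt_eq_bot {n : ℕ} (hn : 1 ≤ n) {d : ℤ} {k j : ℕ}
    (hk : Nat.gcd (dSeq n d k) d.natAbs = 1) (hj : k ≤ j) : kerFilt n d j = ⊥ := by
  have : NeZero n := ⟨by omega⟩
  refine eq_bot_iff.2 ((kerFilt_antitone n d hj).trans (eq_bot_iff.1 ?_))
  have h := finrank_kerFilt_add hn d k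
  have h2 := dSeq_mul_gcd n d k
  rw [hk, mul_one] at h2
  exact Submodule.finrank_eq_zero.1 (by omega)

/-- The difference of two powers of `x` whose exponents differ by a generator of the kernel of
`d ^ (j + 1)` on `ℤ/n`. -/
def chainTop (n : ℕ) (d : ℤ) (j : ℕ) : Rn n := xp n (1 + (dSeq n d (j + 1) : ZMod n)) - xp n 1

lemma posMap_chainTop (n : ℕ) (d : ℤ) (j : ℕ) :
    posMap n (chainTop n d j) = (dSeq n d (j + 1) : ZMod n) := by
  simp [chainTop]

lemma mulMap_pow_chainTop {n : ℕ} (hn : 1 ≤ n) (d : ℤ) (j : ℕ) :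
    (mulMap n d ^ (j + 1)) (chainTop n d j) = 0 := by
  have := (pow_mul_intCast_eq_zero_iff hn d (j + 1) (dSeq n d (j + 1))).2 dvd_rfl
  rw [Int.cast_natCast] at this
  simp [chainTop, mul_add, this]

lemma coeff_mulMap_pow_chainTop {n : ℕ} (hn : 1 ≤ n) {d : ℤ} {j : ℕ}
    (hj : dSeq n d (j + 1) < dSeq n d j) :
    ((mulMap n d ^ j) (chainTop n d j)).coeff ((d : ZMod n) ^ j) = -1 := by
  have : (d : ZMod n) ^ j * (dSeq n d (j + 1) : ZMod n) ≠ 0 := by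
    intro h
    rw [← Int.cast_natCast (R := ZMod n), pow_mul_intCast_eq_zero_iff hn] at h
    have := Nat.le_of_dvd (dSeq_pos hn d _) (Int.natCast_dvd_natCast.1 h)
    omega
  simp [chainTop, mul_add, coeff_xp, this]

lemma coeff_eq_zero_of_mem_kerFilt {n : ℕ} (hn : 1 ≤ n) {d : ℤ} {j : ℕ}
    (hj : dSeq n d (j + 1) < dSeq n d j) {x : Rn n} (hx : x ∈ kerFilt n d (j + 1)) :
    x.coeff ((d : ZMod n) ^ j) = 0 := by
  have : NeZero n := ⟨by omega⟩
  refine mem_range_mulMap_pow_iff.1 hx.2 _ ?_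
  rintro ⟨w, hw⟩
  have hw : (d : ZMod n) ^ (j + 1) * w = (d : ZMod n) ^ j := hw
  have h : Set.range (fun w : ZMod n => (d : ZMod n) ^ j * w) ⊆
      Set.range (fun w : ZMod n => (d : ZMod n) ^ (j + 1) * w) := by
    rintro _ ⟨v, rfl⟩
    exact ⟨w * v, by simp only [← mul_assoc, hw]⟩
  have h2 := Nat.card_mono (Set.toFinite _) h
  rw [card_range_pow_mul hn, card_range_pow_mul hn] at h2
  omega

/-- Tops of the Jordan chains of `mulMap n d` of length `j + 1`, normalised so that all but one of
them are killed by `posMap n`. -/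
lemma exists_chains_of_length {n : ℕ} (hn : 1 ≤ n) {d : ℤ} {j : ℕ}
    (hj : dSeq n d (j + 1) < dSeq n d j) :
    ∃ r : ℕ, (r : ℤ) = (dSeq n d j : ℤ) - 2 * dSeq n d (j + 1) + dSeq n d (j + 2) - 1 ∧
    ∃ b : Option (Fin r) → Rn n, (∀ a, (mulMap n d ^ (j + 1)) (b a) = 0) ∧
      posMap n (b none) = (dSeq n d (j + 1) : ZMod n) ∧ (∀ a, posMap n (b (some a)) = 0) ∧
      (∀ x ∈ kerFilt n d j, ∃ c : Option (Fin r) → ℤ,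
        x - ∑ a, c a • (mulMap n d ^ j) (b a) ∈ kerFilt n d (j + 1)) ∧
      ∀ c : Option (Fin r) → ℤ,
        ∑ a, c a • (mulMap n d ^ j) (b a) ∈ kerFilt n d (j + 1) → ∀ a, c a = 0 := by
  have : NeZero n := ⟨by omega⟩
  let l : Rn n →ₗ[ℤ] ℤ := Finsupp.lapply ((d : ZMod n) ^ j) ∘ₗ
    (AddMonoidAlgebra.coeffLinearEquiv ℤ).toLinearMap
  set z := (mulMap n d ^ j) (chainTop n d j) with hz
  have hlz : l z = -1 := coeff_mulMap_pow_chainTop hn hj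
  have hzN : z ∈ kerFilt n d j := by
    refine ⟨?_, ⟨_, rfl⟩⟩
    change mulMap n d ((mulMap n d ^ j) (chainTop n d j)) = 0
    rw [← Module.End.mul_apply, ← pow_succ', mulMap_pow_chainTop hn]
  have hlN : ∀ x ∈ kerFilt n d (j + 1), l x = 0 := fun x hx => coeff_eq_zero_of_mem_kerFilt hn hj hx
  have hle : kerFilt n d (j + 1) ≤ kerFilt n d j ⊓ LinearMap.ker l :=
    le_inf (kerFilt_antitone n d (Nat.le_succ j)) hlN
  have hH : Module.finrank ℤ (kerFilt n d j ⊓ LinearMap.ker l : Submodule ℤ (Rn n)) + 1 =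
      Module.finrank ℤ (kerFilt n d j) := by
    have h := Submodule.finrank_quotient_add_finrank (LinearMap.ker (l.domRestrict (kerFilt n d j)))
    rw [(LinearMap.quotKerEquivRange _).finrank_eq] at h
    have h1 : LinearMap.range (l.domRestrict (kerFilt n d j)) = ⊤ := by
      refine LinearMap.range_eq_top.2 fun t => ⟨-t • ⟨z, hzN⟩, ?_⟩
      simp [-zsmul_eq_mul, hlz]
    have h2 : (LinearMap.ker (l.domRestrict (kerFilt n d j))).map (kerFilt n d j).subtype =
        kerFilt n d j ⊓ LinearMap.ker l := by
      rw [LinearMap.ker_domRestrict, Submodule.map_comap_subtype]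
    rw [h1, finrank_top, Module.finrank_self, ← Submodule.finrank_map_subtype_eq, h2] at h
    omega
  obtain ⟨r, hr⟩ := Nat.exists_eq_add_of_le (Submodule.finrank_mono hle)
  have hj0 := finrank_kerFilt_add hn d j
  have hj1 := finrank_kerFilt_add hn d (j + 1)
  refine ⟨r, by rw [show j + 2 = j + 1 + 1 from rfl]; omega, ?_⟩
  obtain ⟨u, huA, hus, hui⟩ := exists_complement_basis _ _ hle
    (fun m hm x _ hx => mem_kerFilt_of_smul_mem hm hx) r hr
  have hul : ∀ a, l (u a) = 0 := fun a => (huA a).2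
  have huT : ∀ a, mulMap n d (u a) = 0 := fun a => (huA a).1.1
  have hw : ∀ a, ∃ w, (mulMap n d ^ j) w = u a := fun a => (huA a).1.2
  choose w hw using hw
  have ht : ∀ a, ∃ t : ℤ, posMap n (w a) = t * (dSeq n d (j + 1) : ZMod n) := by
    intro a
    obtain ⟨s, hs⟩ := ZMod.intCast_surjective (posMap n (w a))
    have h0 : (d : ZMod n) ^ (j + 1) * (s : ZMod n) = 0 := by
      rw [hs, ← posMap_mulMap_pow, pow_succ', Module.End.mul_apply, hw, huT, map_zero]
    obtain ⟨t, rfl⟩ := (pow_mul_intCast_eq_zero_iff hn d (j + 1) s).1 h0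
    exact ⟨t, by rw [← hs]; push_cast; ring⟩
  choose t ht using ht
  have hsum : ∀ c : Option (Fin r) → ℤ, ∑ a, c a • (mulMap n d ^ j)
      ((fun a => Option.elim a (chainTop n d j) fun a => w a - t a • chainTop n d j) a) =
      (c none - ∑ a, c (some a) * t a) • z + ∑ a, c (some a) • u a := by
    intro c
    rw [Fintype.sum_option, sub_smul, Finset.sum_smul, sub_add, ← Finset.sum_sub_distrib]
    simp only [Option.elim, map_sub, map_smul, hw, ← hz, smul_sub, mul_smul]
    rw [Finset.sum_sub_distrib, Finset.sum_sub_distrib]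
    abel
  refine ⟨fun a => Option.elim a (chainTop n d j) fun a => w a - t a • chainTop n d j,
    ?_, ?_, ?_, ?_, ?_⟩
  · rintro (_ | a)
    · exact mulMap_pow_chainTop hn d j
    · simp only [Option.elim, map_sub, map_smul, mulMap_pow_chainTop hn, smul_zero, sub_zero]
      rw [pow_succ', Module.End.mul_apply, hw, huT]
  · exact posMap_chainTop n d j
  · intro a
    simp only [Option.elim, map_sub, map_smul, ht, posMap_chainTop]
    rw [zsmul_eq_mul, sub_self]
  · intro x hx
    obtain ⟨c, hc⟩ := hus (x + l x • z) ⟨Submodule.add_mem _ hx (Submodule.smul_mem _ _ hzN), by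
      change l (x + l x • z) = 0
      simp [-zsmul_eq_mul, hlz]⟩
    refine ⟨fun a => Option.elim a (-l x + ∑ a, c a * t a) c, ?_⟩
    rw [hsum]
    convert hc using 1
    simp only [Option.elim, add_sub_cancel_right, neg_smul]
    abel
  · intro c hc
    rw [hsum] at hc
    have h1 := hlN _ hc
    simp only [map_add, map_smul, map_sum, hlz, hul, mul_zero, Finset.sum_const_zero, add_zero,
      smul_eq_mul, mul_neg, mul_one, neg_eq_zero] at h1
    rw [h1, zero_smul, zero_add] at hc
    have h2 := hui _ hc
    rintro (_ | a)
    · simpa [h2] using h1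
    · exact h2 a

lemma eq_zero_of_sum_sigma_eq_zero {M : Type*} [AddCommGroup M] {N : ℕ → Submodule ℤ M}
    (hN : Antitone N) {k : ℕ} {α : Fin k → Type*} [∀ i, Fintype (α i)] (v : ∀ i, α i → M)
    (hv : ∀ (i : Fin k) (a : α i), v i a ∈ N i)
    (hi : ∀ i : Fin k, ∀ c : α i → ℤ, ∑ a, c a • v i a ∈ N (i + 1) → ∀ a, c a = 0)
    (c : (Σ i, α i) → ℤ) (hc : ∑ p : Σ i, α i, c p • v p.1 p.2 = 0) (p : Σ i, α i) : c p = 0 := by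
  rw [Fintype.sum_sigma] at hc
  suffices h : ∀ m : ℕ, ∀ i : Fin k, (i : ℕ) = m → ∀ a, c ⟨i, a⟩ = 0 from h p.1 p.1 rfl p.2
  intro m
  induction m using Nat.strong_induction_on with
  | _ m ih =>
    rintro i rfl
    refine hi i _ ?_
    rw [← Finset.add_sum_erase _ _ (Finset.mem_univ i)] at hc
    rw [eq_neg_of_add_eq_zero_left hc]
    refine Submodule.neg_mem _ (Submodule.sum_mem _ fun i' hi' => Submodule.sum_mem _ fun a _ => ?_)
    rcases lt_or_gt_of_ne (Finset.ne_of_mem_erase hi') with h | h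
    · simp [ih i' h i' rfl]
    · exact Submodule.smul_mem _ _ (hN (Nat.succ_le_of_lt h) (hv i' a))

lemma exists_eq_sum_sigma {M : Type*} [AddCommGroup M] {N : ℕ → Submodule ℤ M}
    {k : ℕ} (hk : ∀ j, k ≤ j → N j = ⊥) {α : Fin k → Type*} [∀ i, Fintype (α i)]
    (v : ∀ i, α i → M)
    (hs : ∀ i : Fin k, ∀ x ∈ N i, ∃ c : α i → ℤ, x - ∑ a, c a • v i a ∈ N (i + 1))
    (j : ℕ) (x : M) (hx : x ∈ N j) :
    ∃ c : (Σ i, α i) → ℤ, (∀ p, (p.1 : ℕ) < j → c p = 0) ∧ x = ∑ p, c p • v p.1 p.2 := by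
  induction hm : k - j generalizing j x with
  | zero =>
    rw [hk j (by omega), Submodule.mem_bot] at hx
    exact ⟨0, fun _ _ => rfl, by simp [hx]⟩
  | succ m ih =>
    let i : Fin k := ⟨j, by omega⟩
    obtain ⟨c₀, h₀⟩ := hs i x hx
    obtain ⟨c, hc, e⟩ := ih (j + 1) _ h₀ (by omega)
    refine ⟨fun p => (Pi.single i c₀ : ∀ i, α i → ℤ) p.1 p.2 + c p, fun p hp => ?_, ?_⟩
    · have h : p.1 ≠ i := fun h => by simp [h, i] at hp
      simp [Pi.single_eq_of_ne h, hc p (by omega)]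
    · simp only [add_smul]
      rw [Finset.sum_add_distrib, ← e, Fintype.sum_sigma, Finset.sum_eq_single i]
      · simp
      · intro i' _ hi'
        simp [Pi.single_eq_of_ne hi']
      · simp

lemma dSeq_succ_lt {n : ℕ} (hn : 1 ≤ n) {d : ℤ} {i : ℕ}
    (hi : Nat.gcd (dSeq n d i) d.natAbs ≠ 1) : dSeq n d (i + 1) < dSeq n d i := by
  have h := dSeq_mul_gcd n d i
  have h1 := dSeq_pos hn d i
  have h2 := dSeq_pos hn d (i + 1)
  have h3 : 0 < Nat.gcd (dSeq n d i) d.natAbs := Nat.gcd_pos_of_pos_left _ h1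
  nlinarith [show 2 ≤ Nat.gcd (dSeq n d i) d.natAbs by omega]

lemma exists_isChainFamily {n : ℕ} (hn : 1 ≤ n) {d : ℤ} {k : ℕ}
    (hk1 : Nat.gcd (dSeq n d k) d.natAbs = 1)
    (hk2 : ∀ i < k, Nat.gcd (dSeq n d i) d.natAbs ≠ 1) :
    ∃ r : Fin k → ℕ, (∀ i : Fin k, (r i : ℤ) =
      (dSeq n d i : ℤ) - 2 * dSeq n d (i + 1) + dSeq n d (i + 2) - 1) ∧
    ∃ b : ∀ i : Fin k, Option (Fin (r i)) → Rn n,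
      IsChainFamily (mulMap n d) (fun p : Σ i, Option (Fin (r i)) => (p.1 : ℕ))
        (fun p => b p.1 p.2) ∧
      (∀ i, posMap n (b i none) = (dSeq n d (i + 1) : ZMod n)) ∧
      ∀ i a, posMap n (b i (some a)) = 0 := by
  choose r hr b hb0 hbn hbs hspan hind using
    fun i : Fin k => exists_chains_of_length hn (dSeq_succ_lt hn (hk2 i i.2))
  refine ⟨r, hr, b, ⟨fun p => hb0 p.1 p.2, fun c hc => ?_, fun j x hx hxj => ?_⟩, hbn, hbs⟩
  · refine eq_zero_of_sum_sigma_eq_zero (kerFilt_antitone n d)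
      (fun i a => (mulMap n d ^ (i : ℕ)) (b i a)) (fun i a => ⟨?_, ⟨_, rfl⟩⟩) hind c hc
    change mulMap n d ((mulMap n d ^ (i : ℕ)) (b i a)) = 0
    rw [← Module.End.mul_apply, ← pow_succ', hb0]
  · exact exists_eq_sum_sigma (fun j hj => kerFilt_eq_bot hn hk1 hj)
      (fun i a => (mulMap n d ^ (i : ℕ)) (b i a)) hspan j x ⟨hx, hxj⟩

lemma exists_isIdempotentElem_pow {M : Type*} [Monoid M] [Finite M] (a : M) :
    ∃ N, N ≠ 0 ∧ a ^ N * a ^ N = a ^ N := by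
  obtain ⟨s, t, hst, h⟩ := Finite.exists_ne_map_eq_of_infinite fun m : ℕ => a ^ m
  wlog hlt : s < t generalizing s t
  · exact this t s hst.symm h.symm (by omega)
  obtain ⟨p, rfl⟩ := Nat.exists_eq_add_of_lt hlt
  have h : a ^ s = a ^ (s + p + 1) := h
  have h1 : ∀ m, a ^ (s + m) = a ^ (s + m + (p + 1)) := by
    intro m
    rw [add_right_comm, pow_add a (s + (p + 1)), ← add_assoc, ← h, ← pow_add]
  have h2 : ∀ l m, a ^ (s + m) = a ^ (s + m + l * (p + 1)) := by
    intro l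
    induction l with
    | zero => simp
    | succ l ih =>
      intro m
      rw [ih, add_assoc s, h1, add_mul, one_mul]
      ring_nf
  refine ⟨(s + 1) * (p + 1), by positivity, ?_⟩
  rw [← pow_add]
  obtain ⟨u, hu⟩ : ∃ u, (s + 1) * (p + 1) = s + u := ⟨(s + 1) * p + 1, by ring⟩
  conv_rhs => rw [hu, h2 (s + 1) u, ← hu]

lemma exists_mulMap_pow_idempotent {n : ℕ} (hn : 1 ≤ n) (d : ℤ) :
    ∃ N, N ≠ 0 ∧ mulMap n d ^ N * mulMap n d ^ N = mulMap n d ^ N := by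
  have : NeZero n := ⟨by omega⟩
  obtain ⟨N, hN, h⟩ := exists_isIdempotentElem_pow (d : ZMod n)
  refine ⟨N, hN, linearMap_ext_xp fun w => ?_⟩
  rw [Module.End.mul_apply, mulMap_pow_xp, mulMap_pow_xp, ← mul_assoc, h]

lemma xp_zero (n : ℕ) : xp n 0 = 1 := rfl

lemma eV_zero (n : ℕ) : eV n 0 = 0 := by
  rw [eV, xp_zero, sub_self]

/-- Residues `0, 1, …, n - 1` exhaust `ℤ/n`. -/
lemma exists_intCast_eq {n : ℕ} (hn : 1 ≤ n) (w : ZMod n) :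
    ∃ v : ℤ, 0 ≤ v ∧ v ≤ (n : ℤ) - 1 ∧ (v : ZMod n) = w := by
  have : NeZero n := ⟨by omega⟩
  have := w.val_lt
  exact ⟨w.val, by omega, by omega, by simp⟩

lemma eV_mem_ZSpan {n : ℕ} (hn : 1 ≤ n) (w : ZMod n) : eV n w ∈ ZSpan n := by
  obtain ⟨v, h0, h1, rfl⟩ := exists_intCast_eq hn w
  rcases h0.eq_or_lt with rfl | h0
  · simp [eV_zero]
  · exact Submodule.subset_span ⟨v, h0, h1, rfl⟩

lemma sub_augMap_smul_one_mem_ZSpan {n : ℕ} (hn : 1 ≤ n) (x : Rn n) :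
    x - augMap n x • (1 : Rn n) ∈ ZSpan n := by
  have h : (ZSpan n).mkQ ∘ₗ (LinearMap.id - (augMap n).smulRight 1) = 0 :=
    linearMap_ext_xp fun w => (Submodule.Quotient.mk_eq_zero _).2 <| by
      simpa [eV] using eV_mem_ZSpan hn w
  exact (Submodule.Quotient.mk_eq_zero _).1 (LinearMap.congr_fun h x)

lemma mem_ZSpan_iff {n : ℕ} (hn : 1 ≤ n) (x : Rn n) : x ∈ ZSpan n ↔ augMap n x = 0 := by
  refine ⟨fun hx => ?_, fun hx => ?_⟩
  · have h : ZSpan n ≤ LinearMap.ker (augMap n) := by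
      refine Submodule.span_le.2 ?_
      rintro _ ⟨v, -, -, rfl⟩
      simp [eV, ← xp_zero]
    exact h hx
  · simpa [hx] using sub_augMap_smul_one_mem_ZSpan hn x

lemma mulMap_mem_ZSpan {n : ℕ} (hn : 1 ≤ n) (d : ℤ) {x : Rn n} (hx : x ∈ ZSpan n) :
    mulMap n d x ∈ ZSpan n := by
  rw [mem_ZSpan_iff hn] at hx ⊢
  rw [← hx]
  simpa using augMap_mulMap_pow n d 1 x

lemma epsV_eq (n : ℕ) (d : ℤ) (w : ZMod n) :
    epsV n d w = (d • LinearMap.id - mulMap n d : Rn n →ₗ[ℤ] Rn n) (eV n w) := by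
  simp [-zsmul_eq_mul, epsV, eV, ← xp_zero, smul_sub]

lemma ESpan_eq_map (n : ℕ) (d : ℤ) :
    ESpan n d = (ZSpan n).map (d • LinearMap.id - mulMap n d) := by
  rw [ESpan, ZSpan, Submodule.map_span]
  congr 1
  ext x
  constructor
  · rintro ⟨v, h0, h1, rfl⟩
    exact ⟨_, ⟨v, h0, h1, rfl⟩, (epsV_eq n d v).symm⟩
  · rintro ⟨_, ⟨v, h0, h1, rfl⟩, rfl⟩
    exact ⟨v, h0, h1, (epsV_eq n d v).symm⟩

lemma xp_mul_xp (n : ℕ) (v w : ZMod n) : xp n v * xp n w = xp n (v + w) := by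
  simp [xp, AddMonoidAlgebra.single_mul_single]

lemma eV_one_mul_xp (n : ℕ) (v : ZMod n) : eV n 1 * xp n v = xp n (v + 1) - xp n v := by
  rw [eV, sub_mul, one_mul, xp_mul_xp, add_comm]

lemma eV_one_mul_sum_xp (n m : ℕ) :
    eV n 1 * ∑ i ∈ Finset.range m, xp n (i : ZMod n) = xp n (m : ZMod n) - 1 := by
  rw [Finset.mul_sum]
  simp only [eV_one_mul_xp]
  have := Finset.sum_range_sub (fun i : ℕ => xp n (i : ZMod n)) m
  simpa [xp_zero] using this

lemma epsV_mem_ESpan {n : ℕ} (hn : 1 ≤ n) (d : ℤ) (w : ZMod n) : epsV n d w ∈ ESpan n d := by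
  rw [ESpan_eq_map, epsV_eq]
  exact Submodule.mem_map_of_mem (eV_mem_ZSpan hn w)

lemma eV_one_mul_fV (n : ℕ) (d v : ℤ) :
    eV n 1 * fV n d v = epsV n d ((v + 1 : ℤ) : ZMod n) - epsV n d (v : ZMod n) := by
  have hs : ∀ u : ZMod n,
      eV n 1 * (xp n u * geomT n d) = xp n (u + (d.natAbs : ZMod n)) - xp n u := by
    intro u
    rw [mul_left_comm, geomT, eV_one_mul_sum_xp, mul_sub, mul_one, xp_mul_xp]
  unfold fV
  split_ifs with h
  · have hd : ((d.natAbs : ℕ) : ZMod n) = (d : ZMod n) := by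
      rw [← Int.cast_natCast, Int.natAbs_of_nonneg h]
    rw [mul_sub, mul_smul_comm, eV_one_mul_xp, hs, hd]
    simp only [epsV, eV, smul_sub]
    push_cast
    rw [mul_add, mul_one]
    abel
  · have hd : ((d.natAbs : ℕ) : ZMod n) = -(d : ZMod n) := by
      rw [← Int.cast_natCast, Int.ofNat_natAbs_of_nonpos (by omega), Int.cast_neg]
    rw [mul_add, mul_smul_comm, eV_one_mul_xp, hs, hd]
    simp only [epsV, eV, smul_sub]
    push_cast
    rw [mul_add, mul_one, add_neg_cancel_right]
    abel

lemma augMap_fV (n : ℕ) (d v : ℤ) : augMap n (fV n d v) = 0 := by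
  have hs : ∀ u : ZMod n, augMap n (xp n u * geomT n d) = |d| := by
    intro u
    simp [geomT, Finset.mul_sum, xp_mul_xp]
  unfold fV
  split_ifs with h
  · rw [map_sub, map_smul, augMap_xp, hs, abs_of_nonneg h, smul_eq_mul, mul_one, sub_self]
  · rw [map_add, map_smul, augMap_xp, hs, abs_of_neg (by omega), smul_eq_mul, mul_one,
      add_neg_cancel]

lemma FSpan_le_ZSpan {n : ℕ} (hn : 1 ≤ n) (d : ℤ) : FSpan n d ≤ ZSpan n := by
  refine Submodule.span_le.2 ?_
  rintro _ ⟨v, -, -, rfl⟩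
  exact (mem_ZSpan_iff hn _).2 (augMap_fV n d v)

lemma map_FSpan {n : ℕ} (hn : 1 ≤ n) (d : ℤ) :
    (FSpan n d).map (LinearMap.mulLeft ℤ (eV n 1)) = ESpan n d := by
  refine le_antisymm ?_ ?_
  · rw [FSpan, Submodule.map_span_le]
    rintro _ ⟨v, -, -, rfl⟩
    rw [LinearMap.mulLeft_apply, eV_one_mul_fV]
    exact Submodule.sub_mem _ (epsV_mem_ESpan hn d _) (epsV_mem_ESpan hn d _)
  · have key : ∀ m : ℕ, ∀ v : ℤ, 1 ≤ v → v + m = n →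
        epsV n d (v : ZMod n) ∈ (FSpan n d).map (LinearMap.mulLeft ℤ (eV n 1)) := by
      intro m
      induction m with
      | zero =>
        intro v _ h
        obtain rfl : v = n := by simpa using h
        simp [epsV, eV_zero]
      | succ m ih =>
        intro v h1 h
        push_cast at h
        have h2 := ih (v + 1) (by omega) (by omega)
        have h3 : fV n d v ∈ FSpan n d := Submodule.subset_span ⟨v, h1, by omega, rfl⟩
        have h4 := Submodule.sub_mem _ h2
          (Submodule.mem_map_of_mem (f := LinearMap.mulLeft ℤ (eV n 1)) h3)
        rwa [LinearMap.mulLeft_apply, eV_one_mul_fV, sub_sub_cancel] at h4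
    refine Submodule.span_le.2 ?_
    rintro _ ⟨v, h0, h1, rfl⟩
    exact key (n - v).toNat v h0 (by omega)

lemma mul_eq_augMap_smul {n : ℕ} {y : Rn n} (hy : ∀ v, xp n v * y = y) (w : Rn n) :
    w * y = augMap n w • y := by
  have h : LinearMap.mulRight ℤ y = (augMap n).smulRight y :=
    linearMap_ext_xp fun v => by simp [hy]
  exact LinearMap.congr_fun h w

lemma xp_mul_sum_xp {n : ℕ} [NeZero n] (v : ZMod n) : xp n v * ∑ w, xp n w = ∑ w, xp n w := by
  rw [Finset.mul_sum]
  simp only [xp_mul_xp]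
  exact Equiv.sum_comp (Equiv.addLeft v) (xp n)

lemma eq_zero_of_eV_one_mul_eq_zero {n : ℕ} (hn : 1 ≤ n) {y : Rn n} (hy : y ∈ ZSpan n)
    (h : eV n 1 * y = 0) : y = 0 := by
  have : NeZero n := ⟨by omega⟩
  have h1 : xp n 1 * y = y := by rwa [eV, sub_mul, one_mul, sub_eq_zero] at h
  have h2 : ∀ m : ℕ, xp n (m : ZMod n) * y = y := by
    intro m
    induction m with
    | zero => rw [Nat.cast_zero, xp_zero, one_mul]
    | succ m ih => rw [Nat.cast_succ, ← xp_mul_xp, mul_assoc, h1, ih]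
  have h3 := mul_eq_augMap_smul (y := y) (fun v => by simpa using h2 v.val) (∑ w, xp n w)
  have h4 := mul_eq_augMap_smul (fun v => xp_mul_sum_xp v) y
  rw [mul_comm, h3, (mem_ZSpan_iff hn y).1 hy, zero_smul] at h4
  refine (smul_eq_zero.1 h4).resolve_left ?_
  simp [NeZero.ne n]

lemma posMap_eV_one_mul (n : ℕ) (w : Rn n) : posMap n (eV n 1 * w) = (augMap n w : ZMod n) := by
  have h : posMap n ∘ₗ LinearMap.mulLeft ℤ (eV n 1) =
      (Int.castAddHom (ZMod n)).toIntLinearMap ∘ₗ augMap n :=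
    linearMap_ext_xp fun v => by simp [eV_one_mul_xp]
  exact LinearMap.congr_fun h w

lemma augMap_eV_one_mul (n : ℕ) (w : Rn n) : augMap n (eV n 1 * w) = 0 := by
  have h : augMap n ∘ₗ LinearMap.mulLeft ℤ (eV n 1) = 0 :=
    linearMap_ext_xp fun v => by simp [eV_one_mul_xp]
  exact LinearMap.congr_fun h w

lemma exists_eV_one_mul_eq {n : ℕ} (hn : 1 ≤ n) {x : Rn n} (hx : x ∈ ZSpan n)
    (hpos : posMap n x = 0) : ∃ w ∈ ZSpan n, eV n 1 * w = x := by
  have : NeZero n := ⟨by omega⟩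
  have h : ZSpan n ≤ LinearMap.range (LinearMap.mulLeft ℤ (eV n 1)) := by
    refine Submodule.span_le.2 ?_
    rintro _ ⟨v, h0, -, rfl⟩
    lift v to ℕ using by omega
    exact ⟨_, by rw [LinearMap.mulLeft_apply, eV_one_mul_sum_xp, Int.cast_natCast, eV]⟩
  obtain ⟨w, rfl⟩ := h hx
  rw [LinearMap.mulLeft_apply, posMap_eV_one_mul, ZMod.intCast_zmod_eq_zero_iff_dvd] at hpos
  obtain ⟨t, ht⟩ := hpos
  refine ⟨w - t • ∑ v, xp n v, (mem_ZSpan_iff hn _).2 ?_, ?_⟩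
  · rw [map_sub, map_smul, ht]
    simp [mul_comm]
  · rw [mul_sub, mul_smul_comm, eV, sub_mul _ _ (∑ v, xp n v), xp_mul_sum_xp]
    simp

/-- Multiplication by `x - 1`, as a homomorphism from the sandpile group to the sand dune group. -/
def sandpileToSandDune {n : ℕ} (hn : 1 ≤ n) (d : ℤ) : Sandpile n d →ₗ[ℤ] SandDune n d :=
  Submodule.mapQ _ _
    ((LinearMap.mulLeft ℤ (eV n 1)).restrict (p := ZSpan n) (q := ZSpan n) fun w _ =>
      (mem_ZSpan_iff hn _).2 (augMap_eV_one_mul n w))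
    fun y hy => by
      change eV n 1 * (y : Rn n) ∈ ESpan n d
      rw [← map_FSpan hn]
      exact Submodule.mem_map_of_mem (f := LinearMap.mulLeft ℤ (eV n 1)) hy

lemma sandpileToSandDune_injective {n : ℕ} (hn : 1 ≤ n) (d : ℤ) :
    Function.Injective (sandpileToSandDune hn d) := by
  rw [injective_iff_map_eq_zero]
  intro y hy
  obtain ⟨y, rfl⟩ := Submodule.Quotient.mk_surjective _ y
  have hy : eV n 1 * (y : Rn n) ∈ ESpan n d :=
    (Submodule.Quotient.mk_eq_zero ((ESpan n d).comap (ZSpan n).subtype)).1 hy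
  rw [← map_FSpan hn] at hy
  obtain ⟨f, hf, e⟩ := hy
  have h := eq_zero_of_eV_one_mul_eq_zero hn
    (Submodule.sub_mem _ (FSpan_le_ZSpan hn d hf) y.2) (by
      rw [mul_sub, ← e, LinearMap.mulLeft_apply, sub_self])
  refine (Submodule.Quotient.mk_eq_zero _).2 ?_
  change (y : Rn n) ∈ FSpan n d
  rwa [← sub_eq_zero.1 h]

/-- The map on the sand dune group induced by `posMap n`. -/
def sandDunePos (n : ℕ) (d : ℤ) : SandDune n d →ₗ[ℤ] ZMod n :=
  Submodule.liftQ _ (posMap n ∘ₗ (ZSpan n).subtype) fun x hx => by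
    have hx : (x : Rn n) ∈ ESpan n d := hx
    rw [ESpan_eq_map] at hx
    obtain ⟨y, -, hy⟩ := hx
    change posMap n (x : Rn n) = 0
    have := posMap_mulMap_pow n d 1 y
    rw [pow_one, pow_one] at this
    rw [← hy, LinearMap.sub_apply, map_sub, this, LinearMap.smul_apply,
      LinearMap.id_apply, map_smul, zsmul_eq_mul, sub_self]

lemma range_sandpileToSandDune {n : ℕ} (hn : 1 ≤ n) (d : ℤ) :
    LinearMap.range (sandpileToSandDune hn d) = LinearMap.ker (sandDunePos n d) := by
  ext x
  constructor
  · rintro ⟨y, rfl⟩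
    obtain ⟨y, rfl⟩ := Submodule.Quotient.mk_surjective _ y
    change posMap n (eV n 1 * (y : Rn n)) = 0
    rw [posMap_eV_one_mul, (mem_ZSpan_iff hn _).1 y.2, Int.cast_zero]
  · intro hx
    obtain ⟨x, rfl⟩ := Submodule.Quotient.mk_surjective _ x
    obtain ⟨w, hw, e⟩ := exists_eV_one_mul_eq hn x.2 hx
    exact ⟨Submodule.Quotient.mk ⟨w, hw⟩, congrArg Submodule.Quotient.mk (Subtype.ext e)⟩

/-- Linear combinations of elements of `ZSpan n`, taken in the sand dune group. -/
def sandDuneComb {ι : Type*} [Fintype ι] (n : ℕ) (d : ℤ) (b : ι → ZSpan n) :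
    (ι → ℤ) →ₗ[ℤ] SandDune n d :=
  Submodule.mkQ _ ∘ₗ Fintype.linearCombination ℤ b

lemma sandDuneComb_eq_mk_iff {ι : Type*} [Fintype ι] {n : ℕ} {d : ℤ} (b : ι → ZSpan n)
    (c : ι → ℤ) (x : ZSpan n) :
    sandDuneComb n d b c = Submodule.Quotient.mk x ↔
      (x : Rn n) - ∑ i, c i • (b i : Rn n) ∈ ESpan n d := by
  rw [eq_comm]
  refine (Submodule.Quotient.eq _).trans ?_
  rw [Submodule.mem_comap, map_sub, Fintype.linearCombination_apply, map_sum]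
  rfl

lemma sandDunePos_sandDuneComb {ι : Type*} [Fintype ι] {n : ℕ} {d : ℤ} (b : ι → ZSpan n)
    (c : ι → ℤ) :
    sandDunePos n d (sandDuneComb n d b c) = ∑ i, (c i : ZMod n) * posMap n (b i) := by
  change posMap n ((ZSpan n).subtype (Fintype.linearCombination ℤ b c)) = _
  rw [Fintype.linearCombination_apply, map_sum, map_sum]
  refine Finset.sum_congr rfl fun i _ => ?_
  rw [map_smul, map_smul, zsmul_eq_mul]
  rfl

/-- The `d ^ k`-torsion of the sand dune group is presented by the tops of the Jordan chains of
`mulMap n d`. -/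
lemma exists_sandDune_presentation {n : ℕ} (hn : 1 ≤ n) {d : ℤ} (hd : 2 ≤ |d|) {k : ℕ}
    (hk1 : Nat.gcd (dSeq n d k) d.natAbs = 1)
    (hk2 : ∀ i < k, Nat.gcd (dSeq n d i) d.natAbs ≠ 1) :
    ∃ r : Fin k → ℕ, (∀ i : Fin k, (r i : ℤ) =
      (dSeq n d i : ℤ) - 2 * dSeq n d (i + 1) + dSeq n d (i + 2) - 1) ∧
    ∃ g : ((Σ i : Fin k, Option (Fin (r i))) → ℤ) →ₗ[ℤ] SandDune n d,
      (∀ c, g c = 0 ↔ ∀ p, d ^ ((p.1 : ℕ) + 1) ∣ c p) ∧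
      (∀ x, d ^ k • x = 0 ↔ ∃ c, g c = x) ∧
      ∀ c, sandDunePos n d (g c) = ∑ i, (c ⟨i, none⟩ : ZMod n) * (dSeq n d (i + 1) : ZMod n) := by
  obtain ⟨r, hr, b, H, hbn, hbs⟩ := exists_isChainFamily hn hk1 hk2
  obtain ⟨N, hN, hT⟩ := exists_mulMap_pow_idempotent hn d
  have hZ : ∀ x ∈ ZSpan n, mulMap n d x ∈ ZSpan n := fun x hx => mulMap_mem_ZSpan hn d hx
  have hbZ : ∀ p : Σ i, Option (Fin (r i)), b p.1 p.2 ∈ ZSpan n := by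
    intro p
    rw [mem_ZSpan_iff hn, ← augMap_mulMap_pow n d (p.1 + 1), H.pow_apply_eq_zero p, map_zero]
  have h0 : ∀ c, sandDuneComb n d (fun p => ⟨b p.1 p.2, hbZ p⟩) c = 0 ↔
      ∀ p, d ^ ((p.1 : ℕ) + 1) ∣ c p := by
    intro c
    rw [← Submodule.Quotient.mk_zero, sandDuneComb_eq_mk_iff, Submodule.coe_zero, zero_sub,
      Submodule.neg_mem_iff, ESpan_eq_map, H.sum_smul_mem_iff hZ hbZ hd hN hT]
  refine ⟨r, hr, sandDuneComb n d fun p => ⟨b p.1 p.2, hbZ p⟩, h0, fun x => ⟨fun hx => ?_, ?_⟩,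
    fun c => ?_⟩
  · obtain ⟨x, rfl⟩ := Submodule.Quotient.mk_surjective _ x
    have hx : d ^ k • (x : Rn n) ∈ ESpan n d := by
      rw [← Submodule.Quotient.mk_smul] at hx
      exact (Submodule.Quotient.mk_eq_zero ((ESpan n d).comap (ZSpan n).subtype)).1 hx
    rw [ESpan_eq_map] at hx
    obtain ⟨c, hc⟩ := H.exists_sub_sum_mem hZ hbZ hN hT k x x.2 hx
    rw [← ESpan_eq_map] at hc
    exact ⟨c, (sandDuneComb_eq_mk_iff _ _ _).2 hc⟩
  · rintro ⟨c, rfl⟩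
    rw [← map_smul, h0]
    exact fun p => Dvd.dvd.mul_right (pow_dvd_pow d p.1.2) _
  · rw [sandDunePos_sandDuneComb, Fintype.sum_sigma]
    refine Finset.sum_congr rfl fun i _ => ?_
    simp [Fintype.sum_option, hbn, hbs]

lemma zmod_natAbs_pow_cast_eq_zero_iff (d : ℤ) (m : ℕ) (c : ℤ) :
    ((c : ℤ) : ZMod (d.natAbs ^ m)) = 0 ↔ d ^ m ∣ c := by
  rw [ZMod.intCast_zmod_eq_zero_iff_dvd, Nat.cast_pow, Int.natCast_natAbs, ← abs_pow, abs_dvd]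

lemma exists_addEquiv_sandDune {n : ℕ} (hn : 1 ≤ n) {d : ℤ} (hd : 2 ≤ |d|) {k : ℕ}
    (hk1 : Nat.gcd (dSeq n d k) d.natAbs = 1)
    (hk2 : ∀ i < k, Nat.gcd (dSeq n d i) d.natAbs ≠ 1) :
    Nonempty ((zsmulAddGroupHom (d ^ k) : SandDune n d →+ SandDune n d).ker ≃+
      ((i : Fin k) →
        (Fin (((dSeq n d i.1 : ℤ) - 2 * (dSeq n d (i.1 + 1) : ℤ) +
            (dSeq n d (i.1 + 2) : ℤ)).toNat) →
          ZMod (d.natAbs ^ (i.1 + 1))))) := by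
  obtain ⟨r, hr, g, hg0, hgr, -⟩ := exists_sandDune_presentation hn hd hk1 hk2
  have e : ∀ i : Fin k, Fin (((dSeq n d i.1 : ℤ) - 2 * (dSeq n d (i.1 + 1) : ℤ) +
      (dSeq n d (i.1 + 2) : ℤ)).toNat) ≃ Option (Fin (r i)) := fun i =>
    (finCongr (by have := hr i; omega)).trans (finSuccEquiv (r i))
  refine nonempty_addEquiv_of_range_eq_of_ker_eq (AddSubgroup.subtype _)
    Subtype.val_injective g.toAddMonoidHom ?_
    { toFun := fun c i a => ((c ⟨i, e i a⟩ : ℤ) : ZMod (d.natAbs ^ (i.1 + 1)))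
      map_zero' := by ext; simp
      map_add' := fun c c' => by ext; simp } ?_ ?_
  · ext x
    rw [AddSubgroup.range_subtype]
    exact hgr x
  · intro y
    choose t ht using fun i a => ZMod.intCast_surjective (y i a)
    refine ⟨fun p => t p.1 ((e p.1).symm p.2), ?_⟩
    ext i a
    simp [ht]
  · ext c
    refine (hg0 c).trans ⟨fun h => ?_, fun h p => ?_⟩
    · ext i a
      exact (zmod_natAbs_pow_cast_eq_zero_iff _ _ _).2 (h _)
    · obtain ⟨i, a⟩ := p
      have := congrFun (congrFun h i) ((e i).symm a)
      simpa using (zmod_natAbs_pow_cast_eq_zero_iff _ _ _).1 this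

lemma forall_pow_dvd_mul_sub_iff {d : ℤ} (hd : d ≠ 0) {δ : ℕ → ℕ} {τ : ℕ → ℤ} {k : ℕ}
    (hδ : ∀ i, δ i ∣ d.natAbs) (hτ : τ k = 0) :
    (∀ i < k, d ^ (i + 1) ∣ δ i * τ i - τ (i + 1)) ↔
      ∀ i < k, ((d.natAbs ^ (i + 1) / δ i : ℕ) : ℤ) ∣ τ i := by
  have hδd : ∀ i, (δ i : ℤ) ∣ d := fun i => Int.natCast_dvd.2 (hδ i)
  have h0 : ∀ i, (δ i : ℤ) ≠ 0 := fun i h => hd (zero_dvd_iff.1 (h ▸ hδd i))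
  have h1 : ∀ i, ((d.natAbs ^ (i + 1) / δ i : ℕ) : ℤ) ∣ τ i ↔ d ^ (i + 1) ∣ δ i * τ i := by
    intro i
    obtain ⟨q, hq⟩ := (hδ i).trans (dvd_pow_self d.natAbs (Nat.succ_ne_zero i))
    have hq' : |d ^ (i + 1)| = δ i * q := by
      rw [abs_pow, ← Int.natCast_natAbs, ← Nat.cast_pow, hq, Nat.cast_mul]
    have hδ0 : 0 < δ i := Nat.pos_of_ne_zero fun h => h0 i (by simp [h])
    rw [← abs_dvd (d ^ (i + 1)), hq', mul_dvd_mul_iff_left (h0 i), hq, Nat.mul_div_cancel_left _ hδ0]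
  simp only [h1]
  have h2 : ∀ i, d ^ (i + 1 + 1) ∣ δ (i + 1) * τ (i + 1) → d ^ (i + 1) ∣ τ (i + 1) := by
    intro i h
    refine (mul_dvd_mul_iff_left (h0 (i + 1))).1 (dvd_trans ?_ h)
    rw [pow_succ' d (i + 1)]
    exact mul_dvd_mul_right (hδd _) _
  constructor
  · intro h i hi
    induction hm : k - i generalizing i with
    | zero => omega
    | succ m ih =>
      have h3 : d ^ (i + 1) ∣ τ (i + 1) := by
        rcases eq_or_ne (i + 1) k with h4 | h4
        · rw [h4, hτ]
          exact dvd_zero _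
        · exact h2 i (ih (i + 1) (by omega) (by omega))
      simpa using dvd_add (h i hi) h3
  · intro h i hi
    refine dvd_sub (h i hi) ?_
    rcases eq_or_ne (i + 1) k with h4 | h4
    · rw [h4, hτ]
      exact dvd_zero _
    · exact h2 i (h (i + 1) (by omega))

lemma sum_mul_dSeq_succ (n : ℕ) (d : ℤ) (τ : ℕ → ℤ) (k : ℕ) :
    ∑ i ∈ Finset.range k, ((Nat.gcd (dSeq n d i) d.natAbs : ℤ) * τ i - τ (i + 1)) *
      dSeq n d (i + 1) = n * τ 0 - dSeq n d k * τ k := by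
  have h := Finset.sum_range_sub' (fun i => (dSeq n d i : ℤ) * τ i) k
  change _ = (n : ℤ) * τ 0 - _ at h
  rw [← h]
  refine Finset.sum_congr rfl fun i _ => ?_
  have h1 : (dSeq n d i : ℤ) = dSeq n d (i + 1) * Nat.gcd (dSeq n d i) d.natAbs := by
    exact_mod_cast (dSeq_mul_gcd n d i).symm
  linear_combination (-τ i) * h1

lemma exists_eq_mul_sub {n : ℕ} (hn : 1 ≤ n) (d : ℤ) (k : ℕ) (c : ℕ → ℤ)
    (hc : (n : ℤ) ∣ ∑ i ∈ Finset.range k, c i * dSeq n d (i + 1)) :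
    ∃ τ : ℕ → ℤ, τ k = 0 ∧
      ∀ i < k, c i = (Nat.gcd (dSeq n d i) d.natAbs : ℤ) * τ i - τ (i + 1) := by
  have h : ∀ i ≤ k, (dSeq n d i : ℤ) ∣ ∑ l ∈ Finset.Ico i k, c l * dSeq n d (l + 1) := by
    intro i hi
    rw [← Finset.sum_range_add_sum_Ico _ hi] at hc
    have h1 : (dSeq n d i : ℤ) ∣ n := Int.natCast_dvd_natCast.2 (dSeq_dvd (Nat.zero_le i))
    refine (dvd_add_right (Finset.dvd_sum fun l hl => ?_)).1 (h1.trans hc)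
    exact Dvd.dvd.mul_left (Int.natCast_dvd_natCast.2 (dSeq_dvd (Finset.mem_range.1 hl))) _
  choose! τ hτ using h
  have h0 : ∀ i, (dSeq n d i : ℤ) ≠ 0 := fun i => by exact_mod_cast (dSeq_pos hn d i).ne'
  refine ⟨τ, ?_, fun i hi => ?_⟩
  · have := hτ k le_rfl
    rw [Finset.Ico_self, Finset.sum_empty, zero_eq_mul] at this
    exact this.resolve_left (h0 k)
  · have h1 := hτ i hi.le
    rw [Finset.sum_eq_sum_Ico_succ_bot hi, hτ (i + 1) hi, ← dSeq_mul_gcd n d i] at h1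
    refine mul_left_cancel₀ (h0 (i + 1)) ?_
    push_cast at h1
    linear_combination h1

/-- Extension by zero of a finite sequence of integers. -/
def extendZero {k : ℕ} (t : Fin k → ℤ) (i : ℕ) : ℤ := if h : i < k then t ⟨i, h⟩ else 0

lemma extendZero_coe {k : ℕ} (t : Fin k → ℤ) (i : Fin k) : extendZero t i = t i :=
  dif_pos i.2

lemma extendZero_self {k : ℕ} (t : Fin k → ℤ) : extendZero t k = 0 := dif_neg (lt_irrefl k)

lemma extendZero_add {k : ℕ} (t s : Fin k → ℤ) (i : ℕ) :
    extendZero (t + s) i = extendZero t i + extendZero s i := by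
  unfold extendZero
  split_ifs <;> simp

lemma extendZero_zero {k : ℕ} (i : ℕ) : extendZero (0 : Fin k → ℤ) i = 0 := by
  simp [extendZero]

/-- Integer vectors `c` indexed like the Jordan chains of `mulMap n d` whose distinguished
coordinates are the differences `gcd(n_i, |d|) * t_i - t_{i+1}`. -/
def chainCoord (n : ℕ) (d : ℤ) {k : ℕ} (r : Fin k → ℕ) :
    (∀ i : Fin k, ℤ × (Fin (r i) → ℤ)) →+ ((Σ i : Fin k, Option (Fin (r i))) → ℤ) where
  toFun t p := Option.elim p.2
    ((Nat.gcd (dSeq n d p.1) d.natAbs : ℤ) * extendZero (fun i => (t i).1) p.1 -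
      extendZero (fun i => (t i).1) (p.1 + 1)) (t p.1).2
  map_zero' := by
    ext ⟨i, _ | a⟩
    · have := fun j => extendZero_zero (k := k) j
      simp only [Pi.zero_def] at this
      simp [this]
    · rfl
  map_add' t s := by
    ext ⟨i, _ | a⟩
    · have := fun j => extendZero_add (fun i => (t i).1) (fun i => (s i).1) j
      simp only [Pi.add_def] at this
      simp only [Option.elim, Pi.add_apply, Prod.fst_add, this]
      ring
    · rfl

lemma exists_addEquiv_sandpile {n : ℕ} (hn : 1 ≤ n) {d : ℤ} (hd : 2 ≤ |d|) {k : ℕ}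
    (hk1 : Nat.gcd (dSeq n d k) d.natAbs = 1)
    (hk2 : ∀ i < k, Nat.gcd (dSeq n d i) d.natAbs ≠ 1) :
    Nonempty ((zsmulAddGroupHom (d ^ k) : Sandpile n d →+ Sandpile n d).ker ≃+
      ((i : Fin k) →
        (ZMod (d.natAbs ^ (i.1 + 1) / Nat.gcd (dSeq n d i.1) d.natAbs) ×
          (Fin (((dSeq n d i.1 : ℤ) - 2 * (dSeq n d (i.1 + 1) : ℤ) +
              (dSeq n d (i.1 + 2) : ℤ) - 1).toNat) →
            ZMod (d.natAbs ^ (i.1 + 1)))))) := by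
  obtain ⟨r, hr, g, hg0, hgr, hgpos⟩ := exists_sandDune_presentation hn hd hk1 hk2
  have hd0 : d ≠ 0 := by
    rintro rfl
    simp at hd
  have e : ∀ i : Fin k, Fin (((dSeq n d i.1 : ℤ) - 2 * (dSeq n d (i.1 + 1) : ℤ) +
      (dSeq n d (i.1 + 2) : ℤ) - 1).toNat) ≃ Fin (r i) := fun i =>
    finCongr (by have := hr i; omega)
  have hpos : ∀ c, sandDunePos n d (g c) = 0 ↔ (n : ℤ) ∣ ∑ i ∈ Finset.range k,
      extendZero (fun i => c ⟨i, none⟩) i * dSeq n d (i + 1) := by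
    intro c
    rw [hgpos, ← ZMod.intCast_zmod_eq_zero_iff_dvd, ← Fin.sum_univ_eq_sum_range
      (fun i => extendZero (fun i => c ⟨i, none⟩) i * (dSeq n d (i + 1) : ℤ))]
    simp [extendZero_coe]
  refine nonempty_addEquiv_of_range_eq_of_ker_eq
    ((sandpileToSandDune hn d).toAddMonoidHom.comp (AddSubgroup.subtype _))
    ((sandpileToSandDune_injective hn d).comp Subtype.val_injective)
    (g.toAddMonoidHom.comp (chainCoord n d r)) ?_
    { toFun := fun t i => (((t i).1 : ℤ), fun a => (((t i).2 (e i a) : ℤ)))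
      map_zero' := by ext <;> simp
      map_add' := fun t s => by ext <;> simp } ?_ ?_
  · ext x
    constructor
    · rintro ⟨⟨y, hy⟩, rfl⟩
      have hy : d ^ k • y = 0 := hy
      obtain ⟨c, hc⟩ := (hgr (sandpileToSandDune hn d y)).1 (by rw [← map_smul, hy, map_zero])
      have h0 : sandDunePos n d (g c) = 0 := by
        rw [hc, ← LinearMap.mem_ker, ← range_sandpileToSandDune hn]
        exact ⟨y, rfl⟩
      obtain ⟨τ, hτk, hτ⟩ := exists_eq_mul_sub hn d k _ ((hpos c).1 h0)
      have hτe : ∀ i ≤ k, extendZero (fun i : Fin k => τ i) i = τ i := by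
        intro i hi
        rcases hi.eq_or_lt with rfl | hi
        · rw [extendZero_self, hτk]
        · exact dif_pos hi
      refine ⟨fun i => (τ i, fun a => c ⟨i, some a⟩), ?_⟩
      refine Eq.trans (congrArg g ?_) hc
      ext ⟨i, _ | a⟩
      · have := hτ i i.2
        rw [extendZero_coe] at this
        simp [chainCoord, this, hτe _ i.2.le, hτe (i + 1) i.2]
      · rfl
    · rintro ⟨t, rfl⟩
      have h0 : sandDunePos n d (g (chainCoord n d r t)) = 0 := by
        rw [hpos]
        have h1 := sum_mul_dSeq_succ n d (extendZero fun i => (t i).1) k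
        rw [extendZero_self, mul_zero, sub_zero] at h1
        refine ⟨_, (Finset.sum_congr rfl fun i hi => ?_).trans h1⟩
        rw [extendZero, dif_pos (Finset.mem_range.1 hi)]
        rfl
      rw [← LinearMap.mem_ker, ← range_sandpileToSandDune hn] at h0
      obtain ⟨y, hy⟩ := h0
      refine ⟨⟨y, ?_⟩, hy⟩
      change d ^ k • y = 0
      refine sandpileToSandDune_injective hn d ?_
      rw [map_smul, map_zero, hy]
      exact (hgr _).2 ⟨_, rfl⟩
  · intro y
    choose s hs using fun i => ZMod.intCast_surjective (y i).1
    choose t ht using fun i a => ZMod.intCast_surjective ((y i).2 a)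
    refine ⟨fun i => (s i, fun a => t i ((e i).symm a)), ?_⟩
    ext i
    · simp [hs]
    · simp [ht]
  · ext t
    have h1 := forall_pow_dvd_mul_sub_iff hd0 (fun i => Nat.gcd_dvd_right (dSeq n d i) d.natAbs)
      (extendZero_self fun i => (t i).1)
    refine (hg0 _).trans ⟨fun h => ?_, fun h => ?_⟩
    · have h2 := h1.1 fun i hi => h ⟨⟨i, hi⟩, none⟩
      ext i
      · refine (ZMod.intCast_zmod_eq_zero_iff_dvd _ _).2 ?_
        have := h2 i i.2
        rwa [extendZero_coe] at this
      · exact (zmod_natAbs_pow_cast_eq_zero_iff _ _ _).2 (h ⟨i, some _⟩)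
    · rintro ⟨i, _ | a⟩
      · refine h1.2 (fun i hi => ?_) i i.2
        have := congrArg Prod.fst (congrFun h ⟨i, hi⟩)
        rw [extendZero, dif_pos hi]
        exact (ZMod.intCast_zmod_eq_zero_iff_dvd _ _).1 this
      · have := congrFun (congrArg Prod.snd (congrFun h i)) ((e i).symm a)
        change d ^ ((i : ℕ) + 1) ∣ (t i).2 a
        exact (zmod_natAbs_pow_cast_eq_zero_iff _ _ _).1 (by simpa using this)

/-- with `d`-sequence `n = n_0 > ⋯ > n_k = n_{k+1}` and
`d_i = gcd(n_i, |d|)`, the kernels `Σ_0(n,d)` and `S_0(n,d)` of `g ↦ d^k·g` satisfy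
`Σ_0(n,d) ≅ ⊕_{i<k} (ℤ/|d|^{i+1})^{n_i − 2n_{i+1} + n_{i+2}}` and
`S_0(n,d) ≅ ⊕_{i<k} (ℤ/(|d|^{i+1}/d_i) ⊕ (ℤ/|d|^{i+1})^{n_i − 2n_{i+1} + n_{i+2} − 1})`. -/
theorem stmt11 (n : ℕ) (d : ℤ) (hn : 1 ≤ n) (hd : 2 ≤ |d|) (k : ℕ)
    (hk1 : Nat.gcd (dSeq n d k) d.natAbs = 1)
    (hk2 : ∀ i < k, Nat.gcd (dSeq n d i) d.natAbs ≠ 1) :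
    Nonempty ((zsmulAddGroupHom (d ^ k) : SandDune n d →+ SandDune n d).ker ≃+
      ((i : Fin k) →
        (Fin (((dSeq n d i.1 : ℤ) - 2 * (dSeq n d (i.1 + 1) : ℤ) +
            (dSeq n d (i.1 + 2) : ℤ)).toNat) →
          ZMod (d.natAbs ^ (i.1 + 1))))) ∧
    Nonempty ((zsmulAddGroupHom (d ^ k) : Sandpile n d →+ Sandpile n d).ker ≃+
      ((i : Fin k) →
        (ZMod (d.natAbs ^ (i.1 + 1) / Nat.gcd (dSeq n d i.1) d.natAbs) ×
          (Fin (((dSeq n d i.1 : ℤ) - 2 * (dSeq n d (i.1 + 1) : ℤ) +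
              (dSeq n d (i.1 + 2) : ℤ) - 1).toNat) →
            ZMod (d.natAbs ^ (i.1 + 1)))))) :=
  ⟨exists_addEquiv_sandDune hn hd hk1 hk2, exists_addEquiv_sandpile hn hd hk1 hk2⟩
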